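/- arXiv:1804.07679 — 2 statements merged into one kernel-verified Lean document; each statement's English description precedes it below -/
import Mathlib

section
/- Let G ⊂ ℝ^d be a closed symmetric convex body and let c(G) = inf{t > 0 : [−1/2,1/2]^d ⊆ tG}. Then for every p ∈ (1,∞) and every f ∈ ℓ^p(ℤ^d) one has ‖ sup_{t ≥ c(G)d} |𝓜_t^G f| ‖_{ℓ^p(ℤ^d)} ≤ e^6 · ‖M_*^G‖_{L^p(ℝ^d)→L^p(ℝ^d)} · ‖f‖_{ℓ^p(ℤ^d)}, where ‖M_*^G‖_{L^p→L^p} is the operator norm of the continuous maximal function F ↦ sup_{t>0}|M_t^G F| on L^p(ℝ^d). -/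
open MeasureTheory ENNReal Pointwise

/-- The ℓ^p(ℤ^d) "norm" of a nonnegative (ℝ≥0∞-valued) function, `p ∈ (0,∞]`. -/
noncomputable def lpZ (d : ℕ) (p : ℝ≥0∞) (g : (Fin d → ℤ) → ℝ≥0∞) : ℝ≥0∞ :=
  if p = ∞ then ⨆ x, g x else (∑' x, g x ^ p.toReal) ^ (1 / p.toReal)

/-- `x ↦ ‖f x‖₊` as an ℝ≥0∞-valued function. -/
noncomputable def nnC {d : ℕ} (f : (Fin d → ℤ) → ℂ) : (Fin d → ℤ) → ℝ≥0∞ :=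
  fun x => (‖f x‖₊ : ℝ≥0∞)

/-- The lattice points of the dilate `G_t = t • G`. -/
def latticeSet (d : ℕ) (G : Set (Fin d → ℝ)) (t : ℝ) : Set (Fin d → ℤ) :=
  {y | t⁻¹ • (fun i => (y i : ℝ)) ∈ G}

/-- The discrete Hardy–Littlewood averaging operator `𝓜_t^G`. -/
noncomputable def discAvg (d : ℕ) (G : Set (Fin d → ℝ)) (t : ℝ)
    (f : (Fin d → ℤ) → ℂ) (x : Fin d → ℤ) : ℂ :=
  ((latticeSet d G t).ncard : ℂ)⁻¹ * ∑' y : latticeSet d G t, f (x - ↑y)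

/-- The continuous Hardy–Littlewood averaging operator `M_t^G`. -/
noncomputable def contAvg (d : ℕ) (G : Set (Fin d → ℝ)) (t : ℝ)
    (F : (Fin d → ℝ) → ℂ) (x : Fin d → ℝ) : ℂ :=
  ((volume (t • G)).toReal : ℂ)⁻¹ * ∫ y in t • G, F (x - y)

/-- The constant `c(G) = inf{t > 0 : [-1/2,1/2]^d ⊆ tG}`. -/
noncomputable def cG (d : ℕ) (G : Set (Fin d → ℝ)) : ℝ :=
  sInf {t : ℝ | 0 < t ∧
    Set.Icc (fun _ => -(1/2 : ℝ)) (fun _ => (1/2 : ℝ)) ⊆ t • G}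

/-- The operator norm `‖M_*^G‖_{L^p(ℝ^d) → L^p(ℝ^d)}` of the continuous maximal function. -/
noncomputable def contMaxNorm (d : ℕ) (G : Set (Fin d → ℝ)) (p : ℝ) : ℝ≥0∞ :=
  ⨆ F : {F : (Fin d → ℝ) → ℂ // eLpNorm F (ENNReal.ofReal p) volume ≤ 1},
    (∫⁻ x, (⨆ t : {t : ℝ // 0 < t}, (‖contAvg d G (↑t) (↑F) x‖₊ : ℝ≥0∞)) ^ p) ^ (1 / p)

/-- coordinatewise rounding -/
noncomputable def rnd {d : ℕ} (z : Fin d → ℝ) : Fin d → ℤ := fun i => round (z i)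

/-- integer vector as a real vector -/
def emb {d : ℕ} (y : Fin d → ℤ) : Fin d → ℝ := fun i => (y i : ℝ)

lemma measurable_rnd {d : ℕ} : Measurable (rnd (d := d)) := by
  refine measurable_pi_lambda _ fun i => ?_
  have : (fun z : Fin d → ℝ => rnd z i) = fun z => ⌊z i + 1/2⌋ := by
    funext z; simp [rnd, round_eq]
  rw [this]
  exact ((measurable_pi_apply i).add_const _).floor

lemma volume_cell {d : ℕ} (y : Fin d → ℤ) : volume (rnd ⁻¹' {y} : Set (Fin d → ℝ)) = 1 := by
  have : (rnd ⁻¹' {y} : Set (Fin d → ℝ)) =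
      Set.pi Set.univ (fun i => Set.Ico ((y i : ℝ) - 1/2) (y i + 1/2)) := by
    ext z
    simp only [Set.mem_preimage, Set.mem_singleton_iff, Set.mem_pi, Set.mem_univ, true_imp_iff,
      funext_iff, rnd, round_eq_iff]
  rw [this, Real.volume_pi_Ico]
  apply Finset.prod_eq_one
  intro i _
  norm_num

lemma lintegral_cells {d : ℕ} (H : (Fin d → ℝ) → ℝ≥0∞) :
    ∫⁻ z, H z = ∑' y : Fin d → ℤ, ∫⁻ z in rnd ⁻¹' {y}, H z := by
  rw [← lintegral_iUnion (fun y => measurable_rnd (measurableSet_singleton y))]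
  · have : (⋃ y : Fin d → ℤ, rnd ⁻¹' {y}) = (Set.univ : Set (Fin d → ℝ)) := by
      ext z; simp
    rw [this, setLIntegral_univ]
  · intro a b hab
    refine Set.disjoint_left.2 ?_
    intro z hz hz'
    exact hab (hz.symm.trans hz')

lemma lintegral_rnd {d : ℕ} (h : (Fin d → ℤ) → ℝ≥0∞) :
    ∫⁻ z, h (rnd z) = ∑' y, h y := by
  rw [lintegral_cells]
  congr 1
  funext y
  rw [setLIntegral_congr_fun (g := fun _ => h y) (measurable_rnd (measurableSet_singleton y))]
  · simp [volume_cell]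
  · intro z hz
    have : rnd z = y := hz
    simp [this]

lemma tsum_le_lintegral {d : ℕ} (a : (Fin d → ℤ) → ℝ≥0∞) (H : (Fin d → ℝ) → ℝ≥0∞)
    (h : ∀ z, a (rnd z) ≤ H z) : ∑' y, a y ≤ ∫⁻ z, H z := by
  rw [← lintegral_rnd]; exact lintegral_mono h

section body
variable {d : ℕ} {G : Set (Fin d → ℝ)}

lemma zero_mem_int (hGconv : Convex ℝ G) (hGsymm : G = -G)
    (hGint : (interior G).Nonempty) : (0 : Fin d → ℝ) ∈ interior G := by
  obtain ⟨x, hx⟩ := hGint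
  have hx' : -x ∈ interior G := by
    rw [hGsymm, ← Set.image_neg_eq_neg]
    have := (Homeomorph.neg (Fin d → ℝ)).image_interior G
    simp only [Homeomorph.coe_neg] at this
    rw [Set.image_neg_eq_neg, Set.image_neg_eq_neg] at this
    rw [Set.image_neg_eq_neg, ← this]
    simpa using hx
  have := hGconv.interior hx hx' (a := 1/2) (b := 1/2) (by norm_num) (by norm_num) (by norm_num)
  simpa using this

lemma smul_mono_body (hGconv : Convex ℝ G) (h0 : (0 : Fin d → ℝ) ∈ G) {s t : ℝ} (hs : 0 ≤ s)
    (hst : s ≤ t) : s • G ⊆ t • G := by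
  have := hGconv.add_smul hs (sub_nonneg.2 hst)
  rw [add_sub_cancel] at this
  rw [this]
  intro x hx
  exact ⟨x, hx, 0, ⟨0, h0, by simp⟩, by simp⟩

lemma cG_spec (hd : 0 < d) (hGconv : Convex ℝ G) (hGclosed : IsClosed G)
    (hGbdd : Bornology.IsBounded G) (h0 : (0 : Fin d → ℝ) ∈ interior G) :
    0 < cG d G ∧ Set.Icc (fun _ => -(1/2 : ℝ)) (fun _ => (1/2 : ℝ)) ⊆ cG d G • G := by
  set S : Set ℝ := {t : ℝ | 0 < t ∧
    Set.Icc (fun _ : Fin d => -(1/2 : ℝ)) (fun _ => (1/2 : ℝ)) ⊆ t • G} with hS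
  have hcS : cG d G = sInf S := rfl
  have hne : S.Nonempty := by
    obtain ⟨ε, hε, hb⟩ := Metric.isOpen_iff.1 isOpen_interior 0 h0
    refine ⟨1/ε, by positivity, ?_⟩
    intro x hx
    rw [Set.mem_smul_set_iff_inv_smul_mem₀ (by positivity)]
    apply interior_subset
    apply hb
    rw [mem_ball_zero_iff, norm_smul]
    have : ‖x‖ ≤ 1/2 := by
      rw [pi_norm_le_iff_of_nonneg (by norm_num)]
      intro i
      rw [Real.norm_eq_abs, abs_le]
      exact ⟨hx.1 i, hx.2 i⟩
    simp only [one_div, inv_inv, Real.norm_eq_abs, abs_of_pos hε]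
    nlinarith
  obtain ⟨M, hM0, hM⟩ := hGbdd.exists_pos_norm_le
  have hlb : ∀ t ∈ S, 1/(2*M) ≤ t := by
    rintro t ⟨ht, htG⟩
    have hh : (fun _ : Fin d => (1/2 : ℝ)) ∈ t • G := htG ⟨fun i => by norm_num, le_refl _⟩
    obtain ⟨g, hg, hgt⟩ := hh
    have h1 := hM g hg
    have h2 := congrFun hgt ⟨0, hd⟩
    have h3 := norm_le_pi_norm g ⟨0, hd⟩
    simp only [Pi.smul_apply, smul_eq_mul] at h2
    rw [Real.norm_eq_abs] at h3
    have h4 := le_abs_self (g ⟨0, hd⟩)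
    rw [div_le_iff₀ (by positivity)]
    nlinarith
  have hpos : 0 < sInf S := lt_of_lt_of_le (by positivity) (le_csInf hne hlb)
  rw [hcS]
  refine ⟨hpos, ?_⟩
  intro x hx
  rw [Set.mem_smul_set_iff_inv_smul_mem₀ hpos.ne']
  have hmem : ∀ t > sInf S, t⁻¹ • x ∈ G := by
    intro t ht
    obtain ⟨s, hs, hst⟩ := exists_lt_of_csInf_lt hne ht
    rw [← Set.mem_smul_set_iff_inv_smul_mem₀ (hpos.trans ht).ne']
    exact smul_mono_body hGconv (interior_subset h0) hs.1.le hst.le (hs.2 hx)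
  have htend : Filter.Tendsto (fun t : ℝ => t⁻¹ • x) (nhdsWithin (sInf S) (Set.Ioi (sInf S)))
      (nhds ((sInf S)⁻¹ • x)) :=
    ((tendsto_inv₀ hpos.ne').smul_const x).mono_left nhdsWithin_le_nhds
  refine hGclosed.mem_of_tendsto htend ?_
  filter_upwards [self_mem_nhdsWithin] with t ht using hmem t ht

/-- in dimension one, dilates below the critical one are short -/
lemma vol_one (hGconv : Convex ℝ G) (hGsymm : G = -G) (hd1 : d = 1) {s : ℝ} (hs : 0 < s)
    (hsc : s < cG d G) : volume (s • G) ≤ 1 := by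
  subst hd1
  have hsub : s • G ⊆ Set.Icc (fun _ => -(1/2 : ℝ)) (fun _ => (1/2 : ℝ)) := by
    by_contra hcon
    rw [Set.not_subset] at hcon
    obtain ⟨y, hy, hyn⟩ := hcon
    have hyabs : 1/2 < |y 0| := by
      by_contra hle
      push Not at hle
      rw [abs_le] at hle
      apply hyn
      refine ⟨fun i => ?_, fun i => ?_⟩ <;> rw [Subsingleton.elim i 0]
      · exact hle.1
      · exact hle.2
    have hQ : Set.Icc (fun _ : Fin 1 => -(1/2 : ℝ)) (fun _ => (1/2 : ℝ)) ⊆ s • G := by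
      intro x hx
      have hny : -y ∈ s • G := by
        rw [hGsymm, Set.smul_set_neg]; simpa using hy
      have hy0 : y 0 ≠ 0 := by
        intro h; rw [h] at hyabs; norm_num at hyabs
      have hr : |x 0 / y 0| ≤ 1 := by
        rw [abs_div, div_le_one (by linarith)]
        have : |x 0| ≤ 1/2 := abs_le.2 ⟨hx.1 0, hx.2 0⟩
        linarith
      rw [abs_le] at hr
      have := (hGconv.smul s) hy hny (a := (1 + x 0 / y 0)/2) (b := (1 - x 0 / y 0)/2)
        (by linarith) (by linarith) (by ring)
      convert this using 1
      funext i
      rw [Subsingleton.elim i 0]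
      simp only [Pi.add_apply, Pi.smul_apply, Pi.neg_apply, smul_eq_mul]
      field_simp
      ring
    have : cG 1 G ≤ s := csInf_le ⟨0, fun t ht => ht.1.le⟩ ⟨hs, hQ⟩
    linarith
  refine (measure_mono hsub).trans ?_
  rw [Real.volume_Icc_pi]
  norm_num

lemma lattice_mem {t : ℝ} (ht : t ≠ 0) (y : Fin d → ℤ) :
    y ∈ latticeSet d G t ↔ emb y ∈ t • G := by
  rw [Set.mem_smul_set_iff_inv_smul_mem₀ ht]; rfl

lemma lattice_finite (hGbdd : Bornology.IsBounded G) {t : ℝ} (ht : t ≠ 0) :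
    (latticeSet d G t).Finite := by
  obtain ⟨M, hM⟩ := (hGbdd.smul₀ t).exists_norm_le
  refine (Set.finite_Icc (fun _ : Fin d => -⌈M⌉) (fun _ => ⌈M⌉)).subset ?_
  intro y hy
  have h1 := hM _ ((lattice_mem ht y).1 hy)
  have h2 : ∀ i, |y i| ≤ ⌈M⌉ := fun i => by
    have := (norm_le_pi_norm (emb y) i).trans h1
    have h3 : ((|y i| : ℤ) : ℝ) ≤ ⌈M⌉ := by
      push_cast
      exact this.trans (Int.le_ceil M)
    exact_mod_cast h3
  exact ⟨fun i => (abs_le.1 (h2 i)).1, fun i => (abs_le.1 (h2 i)).2⟩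

lemma sub_rnd_mem (z : Fin d → ℝ) :
    z - emb (rnd z) ∈ Set.Icc (fun _ => -(1/2 : ℝ)) (fun _ => (1/2 : ℝ)) :=
  ⟨fun i => (abs_le.1 (abs_sub_round (z i))).1, fun i => (abs_le.1 (abs_sub_round (z i))).2⟩

lemma rnd_sub_mem (z : Fin d → ℝ) :
    emb (rnd z) - z ∈ Set.Icc (fun _ => -(1/2 : ℝ)) (fun _ => (1/2 : ℝ)) := by
  have h := sub_rnd_mem z
  refine ⟨fun i => ?_, fun i => ?_⟩
  · have := h.2 i
    simp only [Pi.sub_apply] at *; linarith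
  · have := h.1 i
    simp only [Pi.sub_apply] at *; linarith

lemma vol_smul {s : ℝ} (hs : 0 ≤ s) : volume (s • G) = ENNReal.ofReal (s^d) * volume G := by
  rw [Measure.addHaar_smul]
  simp [abs_of_nonneg hs]

lemma ncard_tsum {S : Set (Fin d → ℤ)} (hS : S.Finite) :
    (S.ncard : ℝ≥0∞) = ∑' y, S.indicator 1 y := by
  rw [← tsum_subtype S (1 : (Fin d → ℤ) → ℝ≥0∞)]
  simp only [Pi.one_apply]
  rw [ENNReal.tsum_one]
  have : ENat.card S = S.encard := rfl
  rw [this, ← hS.cast_ncard_eq]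
  simp

lemma count_lower (hGconv : Convex ℝ G) (hGclosed : IsClosed G)
    (hGbdd : Bornology.IsBounded G) {c t : ℝ} (hc : 0 < c) (hct : c ≤ t)
    (hQ : Set.Icc (fun _ => -(1/2 : ℝ)) (fun _ => (1/2 : ℝ)) ⊆ c • G) :
    volume ((t - c) • G) ≤ (latticeSet d G t).ncard := by
  have ht : t ≠ 0 := by linarith
  rw [ncard_tsum (lattice_finite hGbdd ht), ← lintegral_rnd]
  have hm : MeasurableSet ((t - c) • G) :=
    (Metric.isCompact_of_isClosed_isBounded hGclosed hGbdd |>.smul (t-c)).measurableSet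
  rw [← lintegral_indicator_one hm]
  refine lintegral_mono fun z => ?_
  by_cases hz : z ∈ (t - c) • G
  · have : rnd z ∈ latticeSet d G t := by
      rw [lattice_mem ht]
      have h := hGconv.add_smul (sub_nonneg.2 hct) hc.le
      rw [sub_add_cancel] at h
      rw [h]
      exact ⟨z, hz, _, hQ (rnd_sub_mem z), by simp⟩
    simp [hz, this]
  · simp [hz]

lemma ncard_pos (hGbdd : Bornology.IsBounded G) (h0 : (0 : Fin d → ℝ) ∈ G) {t : ℝ}
    (ht : t ≠ 0) : 1 ≤ (latticeSet d G t).ncard := by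
  rw [Nat.one_le_iff_ne_zero, ← Nat.pos_iff_ne_zero, Set.ncard_pos (lattice_finite hGbdd ht)]
  refine ⟨0, ?_⟩
  simp only [latticeSet, Set.mem_ofPred_eq]
  convert h0
  funext i; simp

lemma count_main (hd : 0 < d) (hGconv : Convex ℝ G) (hGclosed : IsClosed G)
    (hGbdd : Bornology.IsBounded G) (hGsymm : G = -G)
    (h0 : (0 : Fin d → ℝ) ∈ interior G) {t : ℝ} (ht : cG d G * d ≤ t) :
    volume ((t + 2 * cG d G) • G) ≤
      ENNReal.ofReal (Real.exp 6) * (latticeSet d G t).ncard := by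
  obtain ⟨hc, hQ⟩ := cG_spec hd hGconv hGclosed hGbdd h0
  have hone := fun (h : d = 1) => vol_one (s := cG d G / 2) hGconv hGsymm h (by linarith) (by linarith)
  set c := cG d G with hcdef
  have hd1 : (1 : ℝ) ≤ d := by exact_mod_cast hd
  have hct : c ≤ t := by nlinarith
  have hlow := count_lower hGconv hGclosed hGbdd hc hct hQ
  have hNp := ncard_pos hGbdd (interior_subset h0) (t := t) (by linarith)
  have he3 : (4 : ℝ) ≤ Real.exp 3 := by have := Real.add_one_le_exp 3; linarith
  have he6 : (16 : ℝ) ≤ Real.exp 6 := by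
    have : Real.exp 6 = Real.exp 3 * Real.exp 3 := by rw [← Real.exp_add]; norm_num
    nlinarith
  have key : (t + 2*c)^d ≤ Real.exp 6 * (t - c)^d → volume ((t + 2 * c) • G) ≤
      ENNReal.ofReal (Real.exp 6) * (latticeSet d G t).ncard := by
    intro h
    rw [vol_smul (by linarith)] at hlow ⊢
    calc _ ≤ ENNReal.ofReal (Real.exp 6 * (t - c)^d) * volume G := by gcongr
      _ = ENNReal.ofReal (Real.exp 6) * (ENNReal.ofReal ((t-c)^d) * volume G) := by
        rw [ENNReal.ofReal_mul (Real.exp_pos _).le, mul_assoc]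
      _ ≤ _ := by gcongr
  by_cases hd2 : d = 1
  · by_cases h2 : 2 * c ≤ t
    · apply key
      rw [hd2, pow_one, pow_one]
      nlinarith
    · have hv := hone hd2
      have h1 : (t + 2 * c) • G ⊆ (8 : ℝ) • ((c/2) • G) := by
        rw [smul_smul]
        exact smul_mono_body hGconv (interior_subset h0) (by linarith) (by linarith)
      calc _ ≤ volume ((8 : ℝ) • ((c/2) • G)) := measure_mono h1
        _ = ENNReal.ofReal 8 * volume ((c/2) • G) := by
          rw [Measure.addHaar_smul]; simp [hd2]
        _ ≤ ENNReal.ofReal (Real.exp 6) * (latticeSet d G t).ncard := by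
          gcongr
          · linarith
          · exact hv.trans (by exact_mod_cast hNp)
  · apply key
    have hd3 : (2 : ℝ) ≤ d := by
      have : 2 ≤ d := by omega
      exact_mod_cast this
    have hA : t + 2*c ≤ (1 + 6/d) * (t - c) := by
      have h5 : 0 ≤ 6 / (d:ℝ) * (t - c) - 3 * c := by
        rw [div_mul_eq_mul_div, sub_nonneg, le_div_iff₀ (by linarith)]
        nlinarith
      nlinarith
    calc (t+2*c)^d ≤ ((1 + 6/d) * (t - c))^d := by
          apply pow_le_pow_left₀ (by linarith) hA
      _ = (1+6/d)^d * (t-c)^d := mul_pow _ _ _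
      _ ≤ (Real.exp (6/d))^d * (t-c)^d := by
          have := Real.add_one_le_exp (6/(d:ℝ))
          have h7 : 0 ≤ t - c := by linarith
          gcongr
          linarith
      _ = _ := by
          rw [← Real.exp_nat_mul]
          congr 2
          field_simp

end body
lemma lpZ_eq {d : ℕ} {p : ℝ} (hp : 1 < p) (g : (Fin d → ℤ) → ℝ≥0∞) :
    lpZ d (ENNReal.ofReal p) g = (∑' x, g x ^ p) ^ (1 / p) := by
  simp [lpZ, ENNReal.toReal_ofReal (by linarith : 0 ≤ p)]

lemma contAvg_enorm {d : ℕ} {G : Set (Fin d → ℝ)} (hGclosed : IsClosed G)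
    (hGbdd : Bornology.IsBounded G) (hGint : (interior G).Nonempty)
    (φ : (Fin d → ℤ) → ℝ) (hφ : ∀ y, 0 ≤ φ y) (B : ℝ) (hB : ∀ y, φ y ≤ B) {s : ℝ} (hs : 0 < s)
    (v : Fin d → ℝ) :
    ∫⁻ y in s • G, ENNReal.ofReal (φ (rnd (v - y))) =
      volume (s • G) * ‖contAvg d G s (fun z => (φ (rnd z) : ℂ)) v‖ₑ := by
  have hcpt : IsCompact (s • G) :=
    (Metric.isCompact_of_isClosed_isBounded hGclosed hGbdd).smul s
  have hfin : volume (s • G) ≠ ∞ := hcpt.measure_lt_top.ne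
  have hpos : volume (s • G) ≠ 0 := by
    rw [vol_smul hs.le]
    have := (Measure.measure_pos_of_nonempty_interior volume hGint).ne'
    have h2 : 0 < s^d := by positivity
    simp [this, h2]
  have hmeas : Measurable (fun y : Fin d → ℝ => φ (rnd (v - y))) :=
    (measurable_of_countable φ).comp (measurable_rnd.comp (measurable_const.sub measurable_id))
  have hint : Integrable (fun y => φ (rnd (v - y))) (volume.restrict (s • G)) := by
    have : IsFiniteMeasure (volume.restrict (s • G)) := ⟨by simpa using lt_top_iff_ne_top.2 hfin⟩
    refine Integrable.of_bound hmeas.aestronglyMeasurable B (Filter.Eventually.of_forall fun y => ?_)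
    rw [Real.norm_eq_abs, abs_of_nonneg (hφ _)]
    exact hB _
  rw [← ofReal_integral_eq_lintegral_ofReal hint (Filter.Eventually.of_forall fun y => hφ _)]
  unfold contAvg
  rw [integral_complex_ofReal, enorm_mul]
  have h1 : ‖(((volume (s • G)).toReal : ℂ))⁻¹‖ₑ = (volume (s • G))⁻¹ := by
    rw [← Complex.ofReal_inv, ← ofReal_norm, Complex.norm_real, Real.norm_eq_abs,
      abs_of_nonneg (by positivity), ENNReal.ofReal_inv_of_pos (ENNReal.toReal_pos hpos hfin),
      ENNReal.ofReal_toReal hfin]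
  have h2 : ‖((∫ y in s • G, φ (rnd (v - y)) : ℝ) : ℂ)‖ₑ =
      ENNReal.ofReal (∫ y in s • G, φ (rnd (v - y))) := by
    rw [← ofReal_norm, Complex.norm_real, Real.norm_eq_abs,
      abs_of_nonneg (integral_nonneg fun y => hφ _)]
  rw [h1, h2, ← mul_assoc, ENNReal.mul_inv_cancel hpos hfin, one_mul]

lemma disc_le {d : ℕ} {G : Set (Fin d → ℝ)} (hGconv : Convex ℝ G) (hGclosed : IsClosed G)
    (hGbdd : Bornology.IsBounded G) (h0 : (0 : Fin d → ℝ) ∈ G) {c t : ℝ} (hc : 0 < c) (ht : 0 < t)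
    (hQ : Set.Icc (fun _ => -(1/2 : ℝ)) (fun _ => (1/2 : ℝ)) ⊆ c • G)
    (f : (Fin d → ℤ) → ℂ) (v : Fin d → ℝ) :
    ‖discAvg d G t f (rnd v)‖ₑ ≤ ((latticeSet d G t).ncard : ℝ≥0∞)⁻¹ *
      ∫⁻ y in (t + 2 * c) • G, nnC f (rnd (v - y)) := by
  have hN := ncard_pos hGbdd h0 ht.ne'
  have hN' : (0 : ℝ) < (latticeSet d G t).ncard := by exact_mod_cast hN
  unfold discAvg
  rw [enorm_mul]
  have h1 : ‖(((latticeSet d G t).ncard : ℂ))⁻¹‖ₑ = ((latticeSet d G t).ncard : ℝ≥0∞)⁻¹ := by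
    rw [← ofReal_norm, norm_inv, Complex.norm_natCast, ENNReal.ofReal_inv_of_pos hN',
      ENNReal.ofReal_natCast]
  rw [h1]
  gcongr
  refine enorm_tsum_le_tsum_enorm.trans ?_
  have e1 : ∑' y : latticeSet d G t, ‖f (rnd v - ↑y)‖ₑ =
      ∑' y, (latticeSet d G t).indicator (fun y => nnC f (rnd v - y)) y :=
    tsum_subtype (latticeSet d G t) (fun y => nnC f (rnd v - y))
  have hm : MeasurableSet ((t + 2 * c) • G) :=
    (Metric.isCompact_of_isClosed_isBounded hGclosed hGbdd |>.smul (t + 2 * c)).measurableSet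
  rw [e1, ← (Equiv.subLeft (rnd v)).tsum_eq, ← lintegral_indicator hm,
    ← lintegral_sub_left_eq_self _ v]
  apply tsum_le_lintegral
  intro z
  by_cases hz : rnd v - rnd z ∈ latticeSet d G t
  · have : v - z ∈ (t + 2 * c) • G := by
      have h := hGconv.add_smul ht.le (by linarith : 0 ≤ 2 * c)
      have h' := hGconv.add_smul hc.le hc.le
      rw [h, two_mul, h']
      refine ⟨emb (rnd v - rnd z), (lattice_mem ht.ne' _).1 hz, _,
        ⟨_, hQ (sub_rnd_mem v), _, hQ (rnd_sub_mem z), rfl⟩, ?_⟩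
      funext i
      simp [emb]
      ring
    simp [hz, this]
  · simp [hz]

/-- comparison principle (Theorem 1.1). -/
theorem statement0
    (d : ℕ) (hd : 0 < d)
    (G : Set (Fin d → ℝ)) (hGconv : Convex ℝ G) (hGclosed : IsClosed G)
    (hGbdd : Bornology.IsBounded G) (hGsymm : G = -G)
    (hGint : (interior G).Nonempty)
    (p : ℝ) (hp : 1 < p)
    (f : (Fin d → ℤ) → ℂ) (hf : lpZ d (ENNReal.ofReal p) (nnC f) ≠ ∞) :
    lpZ d (ENNReal.ofReal p)
        (fun x => ⨆ t : {t : ℝ // cG d G * d ≤ t}, (‖discAvg d G (↑t) f x‖₊ : ℝ≥0∞))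
      ≤ ENNReal.ofReal (Real.exp 6) * contMaxNorm d G p * lpZ d (ENNReal.ofReal p) (nnC f) := by
  have hp0 : 0 < p := by linarith
  have h0 := zero_mem_int hGconv hGsymm hGint
  have h0' := interior_subset h0
  obtain ⟨hc, hQ⟩ := cG_spec hd hGconv hGclosed hGbdd h0
  set A := lpZ d (ENNReal.ofReal p) (nnC f) with hA
  have hA2 : A = (∑' x, nnC f x ^ p) ^ (1 / p) := lpZ_eq hp _
  have hAp : A ^ p = ∑' x, nnC f x ^ p := by
    rw [hA2, ← ENNReal.rpow_mul, one_div, inv_mul_cancel₀ hp0.ne', ENNReal.rpow_one]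
  have hle : ∀ y, nnC f y ≤ A := fun y => by
    rw [← ENNReal.rpow_le_rpow_iff hp0, hAp]
    exact ENNReal.le_tsum y
  rw [lpZ_eq hp]
  by_cases hA0 : A = 0
  · have hf0 : ∀ y, f y = 0 := fun y => by
      have := hle y
      rw [hA0] at this
      simpa [nnC] using this
    have : ∀ (t : ℝ) (x : Fin d → ℤ), discAvg d G t f x = 0 := by
      intro t x; simp [discAvg, hf0]
    simp [this, hp0]
  set a := A.toReal with ha
  have hapos : 0 < a := ENNReal.toReal_pos hA0 hf
  set φ : (Fin d → ℤ) → ℝ := fun y => ‖f y‖ / a with hφdef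
  have hφ : ∀ y, 0 ≤ φ y := fun y => by positivity
  have hnn : ∀ y, nnC f y = ENNReal.ofReal ‖f y‖ := fun y => (ofReal_norm (f y)).symm
  have hAa : A = ENNReal.ofReal a := (ENNReal.ofReal_toReal hf).symm
  have hφ1 : ∀ y, φ y ≤ 1 := fun y => by
    have := hle y
    rw [hnn, hAa, ENNReal.ofReal_le_ofReal_iff hapos.le] at this
    exact (div_le_one hapos).2 this
  have hhφ : ∀ y, nnC f y = A * ENNReal.ofReal (φ y) := fun y => by
    rw [hnn, hAa, ← ENNReal.ofReal_mul hapos.le]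
    congr 1
    simp only [hφdef]
    field_simp
  set F : (Fin d → ℝ) → ℂ := fun z => (φ (rnd z) : ℂ) with hF
  have hFn : ∀ z, ‖F z‖ₑ = ENNReal.ofReal (φ (rnd z)) := fun z => by
    rw [← ofReal_norm, hF, Complex.norm_real, Real.norm_eq_abs, abs_of_nonneg (hφ _)]
  have hF1 : eLpNorm F (ENNReal.ofReal p) volume ≤ 1 := by
    rw [eLpNorm_eq_eLpNorm' (by simpa using hp0) ENNReal.ofReal_ne_top,
      ENNReal.toReal_ofReal hp0.le, eLpNorm'_eq_lintegral_enorm]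
    simp_rw [hFn]
    rw [lintegral_rnd (fun y => ENNReal.ofReal (φ y) ^ p)]
    have hsum : A ^ p * ∑' y, ENNReal.ofReal (φ y) ^ p = A ^ p * 1 := by
      rw [← ENNReal.tsum_mul_left, mul_one]
      refine Eq.trans ?_ hAp.symm
      congr 1
      funext y
      rw [hhφ, ENNReal.mul_rpow_of_nonneg _ _ hp0.le]
    have hAp0 : A ^ p ≠ 0 := by simp [hA0, hp0.le]
    have hApt : A ^ p ≠ ∞ := ENNReal.rpow_ne_top_of_nonneg hp0.le hf
    rw [(ENNReal.mul_right_inj hAp0 hApt).1 hsum, ENNReal.one_rpow]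
  set E := ENNReal.ofReal (Real.exp 6) with hE
  set Mst : (Fin d → ℝ) → ℝ≥0∞ :=
    fun v => ⨆ t : {t : ℝ // 0 < t}, (‖contAvg d G (↑t) F v‖₊ : ℝ≥0∞) with hMst
  have hpt : ∀ v : Fin d → ℝ,
      (⨆ t : {t : ℝ // cG d G * d ≤ t}, (‖discAvg d G (↑t) f (rnd v)‖₊ : ℝ≥0∞)) ≤
        E * A * Mst v := by
    intro v
    refine iSup_le fun ⟨t, ht⟩ => ?_
    have hd1 : (1 : ℝ) ≤ d := by exact_mod_cast hd
    have htpos : 0 < t := by nlinarith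
    have hs : 0 < t + 2 * cG d G := by linarith
    have hN := ncard_pos hGbdd h0' htpos.ne'
    have hN0 : ((latticeSet d G t).ncard : ℝ≥0∞) ≠ 0 := by
      exact_mod_cast (by omega : (latticeSet d G t).ncard ≠ 0)
    have hcm := count_main hd hGconv hGclosed hGbdd hGsymm h0 ht
    have hM : ‖contAvg d G (t + 2 * cG d G) F v‖ₑ ≤ Mst v :=
      le_iSup (fun t : {t : ℝ // 0 < t} => (‖contAvg d G (↑t) F v‖₊ : ℝ≥0∞))
        ⟨t + 2 * cG d G, hs⟩
    refine (disc_le hGconv hGclosed hGbdd h0' hc htpos hQ f v).trans ?_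
    simp_rw [hhφ]
    rw [lintegral_const_mul' _ _ hf,
      contAvg_enorm hGclosed hGbdd hGint φ hφ 1 hφ1 hs v]
    calc _ ≤ ((latticeSet d G t).ncard : ℝ≥0∞)⁻¹ *
          (A * ((E * (latticeSet d G t).ncard) * Mst v)) := by gcongr
      _ = (((latticeSet d G t).ncard : ℝ≥0∞)⁻¹ * (latticeSet d G t).ncard) * (E * A * Mst v) := by
          ring
      _ = E * A * Mst v := by
          rw [ENNReal.inv_mul_cancel hN0 (ENNReal.natCast_ne_top _), one_mul]
  have hEA : E * A ≠ ∞ := ENNReal.mul_ne_top ENNReal.ofReal_ne_top hf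
  have hcont : (∫⁻ v, Mst v ^ p) ^ (1 / p) ≤ contMaxNorm d G p :=
    le_iSup (fun F : {F : (Fin d → ℝ) → ℂ // eLpNorm F (ENNReal.ofReal p) volume ≤ 1} =>
      (∫⁻ x, (⨆ t : {t : ℝ // 0 < t}, (‖contAvg d G (↑t) (↑F) x‖₊ : ℝ≥0∞)) ^ p) ^ (1 / p))
      ⟨F, hF1⟩
  have hsum : ∑' x : Fin d → ℤ,
      (⨆ t : {t : ℝ // cG d G * d ≤ t}, (‖discAvg d G (↑t) f x‖₊ : ℝ≥0∞)) ^ p ≤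
      (E * A) ^ p * ∫⁻ v, Mst v ^ p := by
    rw [← lintegral_const_mul' _ _ (ENNReal.rpow_ne_top_of_nonneg hp0.le hEA)]
    apply tsum_le_lintegral
    intro v
    rw [← ENNReal.mul_rpow_of_nonneg _ _ hp0.le]
    exact ENNReal.rpow_le_rpow (hpt v) hp0.le
  calc _ ≤ ((E * A) ^ p * ∫⁻ v, Mst v ^ p) ^ (1 / p) :=
        ENNReal.rpow_le_rpow hsum (by positivity)
    _ = E * A * (∫⁻ v, Mst v ^ p) ^ (1 / p) := by
        rw [ENNReal.mul_rpow_of_nonneg _ _ (by positivity), ← ENNReal.rpow_mul, mul_one_div,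
          div_self hp0.ne', ENNReal.rpow_one]
    _ ≤ E * A * contMaxNorm d G p := by gcongr
    _ = E * contMaxNorm d G p * A := by ring
end

section
/- For every p ∈ (1,∞) there exists a constant C_p > 0 such that for every d ∈ ℕ and every sequence 1 ≤ λ_1 < λ_2 < … < λ_d < √2, the ellipsoid E_d = {x ∈ ℝ^d : Σ_{j=1}^d λ_j² x_j² ≤ 1} satisfies 𝓒_p(E_d) ≥ C_p (log d)^{1/p}, where 𝓒_p(E_d) = sup{ ‖ sup_{t>0} |𝓜_t^{E_d} f| ‖_{ℓ^p(ℤ^d)} : ‖f‖_{ℓ^p(ℤ^d)} ≤ 1 } is the ℓ^p operator norm of the full discrete Hardy–Littlewood maximal function over E_d. -/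
open MeasureTheory ENNReal Pointwise

/-- The ellipsoid `E_d = {x : Σ λ_j² x_j² ≤ 1}`. -/
def ellipsoid (d : ℕ) (lam : Fin d → ℝ) : Set (Fin d → ℝ) :=
  {x | ∑ j, lam j ^ 2 * x j ^ 2 ≤ 1}

namespace Aux

def col {d : ℕ} (j : Fin d) : ℕ := Nat.log 2 (j.1 + 1)

def flip {d : ℕ} (j : Fin d) (x : Fin d → ℤ) : Fin d → ℤ := Function.update x j (1 - x j)

def S {d : ℕ} (i : ℕ) (x : Fin d → ℤ) : ℤ := ∑ j, if col j = i then x j else 0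

def cube (d : ℕ) : Finset (Fin d → ℤ) := Fintype.piFinset fun _ => {0, 1}

open Classical in
noncomputable def A (d : ℕ) : Finset (Fin d → ℤ) := (cube d).filter fun x => ∀ i, Even (S i x)

open Classical in
noncomputable def B (d i : ℕ) : Finset (Fin d → ℤ) :=
  (cube d).filter fun x => ∀ i', (Even (S i' x) ↔ i' ≠ i)

lemma flip_flip {d : ℕ} (j : Fin d) (x : Fin d → ℤ) : flip j (flip j x) = x := by
  simp [flip]

lemma flip_cube {d : ℕ} (j : Fin d) {x : Fin d → ℤ} (hx : x ∈ cube d) : flip j x ∈ cube d := by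
  simp only [cube, Fintype.mem_piFinset, Finset.mem_insert, Finset.mem_singleton] at hx ⊢
  intro a
  by_cases h : a = j
  · subst h
    rcases hx a with h | h <;> simp [flip, h]
  · simpa [flip, h] using hx a

lemma S_flip {d : ℕ} (j : Fin d) (x : Fin d → ℤ) (i : ℕ) :
    S i (flip j x) = S i x + if col j = i then 1 - 2 * x j else 0 := by
  have : ∀ a, (if col a = i then flip j x a else 0) = (if col a = i then x a else 0) +
      if a = j then (if col j = i then 1 - 2 * x j else 0) else 0 := by
    intro a
    by_cases h : a = j
    · subst h
      by_cases h2 : col a = i <;> simp [flip, h2]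
      ring
    · simp [flip, h]
  simp only [S, this, Finset.sum_add_distrib]
  simp

lemma even_flip {d : ℕ} (j : Fin d) (x : Fin d → ℤ) (i : ℕ) :
    Even (S i (flip j x)) ↔ (if col j = i then ¬ Even (S i x) else Even (S i x)) := by
  rw [S_flip]
  split_ifs with h
  · have : Odd (1 - 2 * x j) := ⟨- x j, by ring⟩
    rw [Int.even_add]
    have h2 := Int.not_even_iff_odd.2 this
    tauto
  · simp

lemma flip_mem_A {d i : ℕ} {j : Fin d} (hj : col j = i) {x : Fin d → ℤ} (hx : x ∈ B d i) :
    flip j x ∈ A d := by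
  classical
  simp only [A, B, Finset.mem_filter] at hx ⊢
  refine ⟨flip_cube j hx.1, fun i' => ?_⟩
  rw [even_flip]
  split_ifs with h
  · rw [hx.2]; simp [← h, hj]
  · rw [hx.2]; rintro rfl; exact h hj

lemma flip_mem_B {d i : ℕ} {j : Fin d} (hj : col j = i) {x : Fin d → ℤ} (hx : x ∈ A d) :
    flip j x ∈ B d i := by
  classical
  simp only [A, B, Finset.mem_filter] at hx ⊢
  refine ⟨flip_cube j hx.1, fun i' => ?_⟩
  rw [even_flip]
  split_ifs with h
  · have := hx.2 i'
    have h3 : i' = i := h ▸ hj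
    tauto
  · simp only [hx.2 i', true_iff]; rintro rfl; exact h hj

lemma card_B {d i : ℕ} {j : Fin d} (hj : col j = i) : (A d).card ≤ (B d i).card := by
  apply Finset.card_le_card_of_injOn (flip j)
  · intro x hx; exact flip_mem_B hj hx
  · intro x _ y _ h
    have := congrArg (flip j) h
    simpa [flip_flip] using this

lemma A_nonempty (d : ℕ) : 0 < (A d).card := by
  classical
  apply Finset.card_pos.2
  refine ⟨0, ?_⟩
  rw [A, Finset.mem_filter]
  simp [cube, S]

lemma B_disj (d : ℕ) {i i' : ℕ} (h : i ≠ i') : Disjoint (B d i) (B d i') := by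
  classical
  rw [Finset.disjoint_left]
  intro x hx hx'
  simp only [B, Finset.mem_filter] at hx hx'
  have h1 := hx.2 i
  have h2 := hx'.2 i
  simp_all

def T {d : ℕ} (k : Fin d) : Finset (Fin d → ℤ) :=
  insert 0 ((Finset.Iic k).image (fun j => Pi.single j 1) ∪
    (Finset.Iic k).image (fun j => Pi.single j (-1)))

lemma card_T {d : ℕ} (k : Fin d) : (T k).card ≤ 2 * (k.1 + 1) + 1 := by
  unfold T
  refine (Finset.card_insert_le _ _).trans ?_
  have h1 := Finset.card_union_le ((Finset.Iic k).image (fun j => (Pi.single j 1 : Fin d → ℤ)))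
    ((Finset.Iic k).image (fun j => (Pi.single j (-1) : Fin d → ℤ)))
  have h2 := Finset.card_image_le (s := Finset.Iic k) (f := fun j => (Pi.single j 1 : Fin d → ℤ))
  have h3 := Finset.card_image_le (s := Finset.Iic k) (f := fun j => (Pi.single j (-1) : Fin d → ℤ))
  rw [Fin.card_Iic] at h2 h3
  omega

lemma mem_lattice {d : ℕ} (lam : Fin d → ℝ) {t : ℝ} (ht : 0 < t) (y : Fin d → ℤ) :
    y ∈ latticeSet d (ellipsoid d lam) t ↔ ∑ j, lam j ^ 2 * (y j : ℝ) ^ 2 ≤ t ^ 2 := by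
  have : ∑ j, lam j ^ 2 * (t⁻¹ * (y j : ℝ)) ^ 2 = (∑ j, lam j ^ 2 * (y j : ℝ) ^ 2) / t ^ 2 := by
    rw [Finset.sum_div]
    refine Finset.sum_congr rfl fun j _ => ?_
    field_simp
  simp only [latticeSet, ellipsoid, Set.mem_ofPred_eq, Pi.smul_apply, smul_eq_mul]
  rw [this, div_le_one (by positivity)]

lemma lattice_sub {d : ℕ} (lam : Fin d → ℝ) (h1 : ∀ j, 1 ≤ lam j) (hm : StrictMono lam)
    (h2 : ∀ j, lam j < Real.sqrt 2) (k : Fin d) :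
    latticeSet d (ellipsoid d lam) (lam k) ⊆ (T k : Set (Fin d → ℤ)) := by
  intro y hy
  have hk0 : 0 < lam k := lt_of_lt_of_le one_pos (h1 k)
  rw [mem_lattice lam hk0] at hy
  have hk2 : lam k ^ 2 < 2 := by
    have := Real.sq_sqrt (show (0:ℝ) ≤ 2 by norm_num)
    nlinarith [h2 k, Real.sqrt_nonneg 2]
  have hs : ∑ j, (y j : ℝ) ^ 2 ≤ ∑ j, lam j ^ 2 * (y j : ℝ) ^ 2 := by
    refine Finset.sum_le_sum fun j _ => ?_
    have : 1 ≤ lam j ^ 2 := one_le_pow₀ (h1 j)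
    nlinarith [sq_nonneg (y j : ℝ)]
  have hz : ∑ j, (y j) ^ 2 < 2 := by
    have : ((∑ j, (y j) ^ 2 : ℤ) : ℝ) < 2 := by push_cast; linarith
    exact_mod_cast this
  by_cases h0 : y = 0
  · simp [T, h0]
  obtain ⟨j, hj⟩ := Function.ne_iff.1 h0
  simp only [Pi.zero_apply] at hj
  have hjp : 1 ≤ y j ^ 2 := by have := sq_pos_of_ne_zero hj; omega
  have hsplit := Finset.add_sum_erase Finset.univ (fun a => y a ^ 2) (Finset.mem_univ j)
  have hoth : ∀ a, a ≠ j → y a = 0 := by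
    intro a ha
    by_contra hc
    have h3 : 1 ≤ y a ^ 2 := by have := sq_pos_of_ne_zero hc; omega
    have h4 := Finset.single_le_sum (f := fun a => y a ^ 2) (s := Finset.univ.erase j)
      (fun b _ => sq_nonneg _) (Finset.mem_erase.2 ⟨ha, Finset.mem_univ a⟩)
    omega
  have hrest : 0 ≤ ∑ a ∈ Finset.univ.erase j, y a ^ 2 := Finset.sum_nonneg fun b _ => sq_nonneg _
  have hj1 : y j ^ 2 = 1 := by omega
  have hjk : j ≤ k := by
    rw [← hm.le_iff_le]
    have h5 := Finset.single_le_sum (f := fun a => lam a ^ 2 * (y a : ℝ) ^ 2) (s := Finset.univ)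
      (fun b _ => by positivity) (Finset.mem_univ j)
    have h6 : (y j : ℝ) ^ 2 = 1 := by exact_mod_cast hj1
    simp only [h6, mul_one] at h5
    exact abs_le_of_sq_le_sq' (h5.trans hy) hk0.le |>.2
  have hys : y = Pi.single j (y j) := by
    ext a
    by_cases ha : a = j
    · subst ha; simp
    · simp [ha, hoth a ha]
  simp only [T, Finset.coe_insert, Finset.coe_union, Finset.coe_image, Set.mem_insert_iff,
    Set.mem_union, Set.mem_image, Finset.coe_Iic, Set.mem_Iic]
  right
  rcases (by simpa using hj1 : y j = 1 ∨ y j = -1) with h | h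
  · left; exact ⟨j, hjk, by rw [hys, h]⟩
  · right; exact ⟨j, hjk, by rw [hys, h]⟩

noncomputable def g (d : ℕ) (a : ℝ) : (Fin d → ℤ) → ℝ :=
  Set.indicator (A d : Set (Fin d → ℤ)) fun _ => a

lemma avg_lower {d : ℕ} (lam : Fin d → ℝ) (h1 : ∀ j, 1 ≤ lam j) (hm : StrictMono lam)
    (h2 : ∀ j, lam j < Real.sqrt 2) (i : ℕ) (hi : 2 ^ (i + 1) ≤ d + 1) (a : ℝ) (ha : 0 ≤ a)
    (x : Fin d → ℤ) (hx : x ∈ B d i) :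
    ∃ t : ℝ, 0 < t ∧ a / 4 ≤ ‖discAvg d (ellipsoid d lam) t (fun z => (g d a z : ℂ)) x‖ := by
  classical
  have hpow : 0 < 2 ^ i := by positivity
  have hps : 2 ^ (i + 1) = 2 * 2 ^ i := by ring
  let k : Fin d := ⟨2 ^ (i + 1) - 2, by omega⟩
  let l : Fin d := ⟨2 ^ i - 1, by omega⟩
  have hk0 : 0 < lam k := lt_of_lt_of_le one_pos (h1 k)
  refine ⟨lam k, hk0, ?_⟩
  set L := latticeSet d (ellipsoid d lam) (lam k) with hL
  have hsub : L ⊆ (T k : Set _) := lattice_sub lam h1 hm h2 k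
  have hfin : L.Finite := (T k).finite_toSet.subset hsub
  have hcard : L.ncard ≤ 4 * 2 ^ i := by
    have e1 := Set.ncard_le_ncard hsub (T k).finite_toSet
    rw [Set.ncard_coe_finset] at e1
    have e2 := card_T k
    have : k.1 = 2 ^ (i + 1) - 2 := rfl
    omega
  have hxc : ∀ j, x j = 0 ∨ x j = 1 := by
    have := (Finset.mem_filter.1 hx).1
    simpa [cube, Fintype.mem_piFinset] using this
  have hyv : ∀ j, x - flip j x = Pi.single j (2 * x j - 1) := by
    intro j
    ext b
    by_cases hb : b = j
    · subst hb; simp [flip]; ring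
    · simp [flip, hb]
  have hmemL : ∀ j, j ≤ k → x - flip j x ∈ L := by
    intro j hj
    rw [hL, mem_lattice lam hk0, hyv, Finset.sum_eq_single j]
    · have : ((2 * x j - 1 : ℤ) : ℝ) ^ 2 = 1 := by rcases hxc j with h | h <;> simp [h]
      rw [Pi.single_eq_same, this, mul_one]
      exact pow_le_pow_left₀ (by linarith [h1 j]) (hm.monotone hj) 2
    · intro b _ hb; simp [hb]
    · simp
  have hinj : Set.InjOn (fun j => x - flip j x) (Finset.Icc l k : Set (Fin d)) := by
    intro j _ j' _ h
    by_contra hne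
    have := congrFun h j
    dsimp only at this
    rw [hyv, hyv, Pi.single_eq_same, Pi.single_eq_of_ne hne] at this
    omega
  have hcol : ∀ j ∈ Finset.Icc l k, col j = i := by
    intro j hj
    rw [Finset.mem_Icc, Fin.le_def, Fin.le_def] at hj
    have e1 : l.1 = 2 ^ i - 1 := rfl
    have e2 : k.1 = 2 ^ (i + 1) - 2 := rfl
    unfold col
    rw [Nat.log_eq_iff (Or.inr ⟨by norm_num, by omega⟩)]
    omega
  have hsum : (2 ^ i : ℝ) * a ≤ ∑ y ∈ hfin.toFinset, g d a (x - y) := by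
    calc (2 ^ i : ℝ) * a = ∑ j ∈ Finset.Icc l k, a := by
          rw [Finset.sum_const, Fin.card_Icc, nsmul_eq_mul]
          have : k.1 + 1 - l.1 = 2 ^ i := by
            show 2 ^ (i + 1) - 2 + 1 - (2 ^ i - 1) = 2 ^ i
            omega
          rw [this]; push_cast; rfl
      _ = ∑ j ∈ Finset.Icc l k, g d a (x - (x - flip j x)) := by
          refine Finset.sum_congr rfl fun j hj => ?_
          rw [_root_.sub_sub_cancel, g, Set.indicator_of_mem]
          exact flip_mem_A (hcol j hj) hx
      _ = ∑ y ∈ (Finset.Icc l k).image (fun j => x - flip j x), g d a (x - y) := by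
          rw [Finset.sum_image hinj]
      _ ≤ _ := by
          refine Finset.sum_le_sum_of_subset_of_nonneg ?_ ?_
          · intro y hy
            obtain ⟨j, hj, rfl⟩ := Finset.mem_image.1 hy
            rw [Set.Finite.mem_toFinset]
            exact hmemL j (Finset.mem_Icc.1 hj).2
          · intro y _ _
            exact Set.indicator_nonneg (fun _ _ => ha) _
  have hnpos : 0 < L.ncard := by
    rw [Set.ncard_pos hfin]
    exact ⟨_, hmemL k le_rfl⟩
  have hts : (∑' y : L, ((g d a (x - ↑y) : ℝ) : ℂ)) =
      ((∑ y ∈ hfin.toFinset, g d a (x - y) : ℝ) : ℂ) := by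
    have e : L = (hfin.toFinset : Set (Fin d → ℤ)) := by simp
    push_cast
    rw [tsum_subtype L (fun y => ((g d a (x - y) : ℝ) : ℂ))]
    conv_lhs => rw [e]
    rw [← tsum_subtype]
    exact Finset.tsum_subtype hfin.toFinset (fun y => ((g d a (x - y) : ℝ) : ℂ))
  unfold discAvg
  rw [← hL, hts, norm_mul, norm_inv, Complex.norm_natCast, Complex.norm_real]
  have hn : (0:ℝ) < L.ncard := by exact_mod_cast hnpos
  have hc : (L.ncard : ℝ) ≤ 4 * 2 ^ i := by exact_mod_cast hcard
  rw [inv_mul_eq_div, le_div_iff₀ hn]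
  refine le_trans ?_ (hsum.trans (le_abs_self _))
  nlinarith

end Aux

open Aux in
/-- the ℓ^p operator norm of the full maximal function over the ellipsoid
grows at least like `(log d)^{1/p}` (Theorem 1.2). -/
theorem statement1 (p : ℝ) (hp : 1 < p) :
    ∃ C : ℝ, 0 < C ∧ ∀ (d : ℕ), 0 < d → ∀ lam : Fin d → ℝ,
      (∀ j, 1 ≤ lam j) → StrictMono lam → (∀ j, lam j < Real.sqrt 2) →
      ENNReal.ofReal (C * Real.log d ^ (1 / p)) ≤
        ⨆ f : {f : (Fin d → ℤ) → ℂ // lpZ d (ENNReal.ofReal p) (nnC f) ≤ 1},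
          lpZ d (ENNReal.ofReal p)
            (fun x => ⨆ t : {t : ℝ // 0 < t},
              (‖discAvg d (ellipsoid d lam) (↑t) (↑f) x‖₊ : ℝ≥0∞)) := by
  refine ⟨1 / 8, by norm_num, fun d hd lam h1 hm h2 => ?_⟩
  classical
  have hp0 : 0 < p := by linarith
  have hpR : (ENNReal.ofReal p).toReal = p := ENNReal.toReal_ofReal hp0.le
  set n : ℕ := (A d).card with hn
  have hn0 : (0:ℝ) < n := by exact_mod_cast A_nonempty d
  set a : ℝ := ((n:ℝ)⁻¹) ^ (1 / p) with ha
  have ha0 : 0 ≤ a := by positivity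
  have hap : a ^ p = (n:ℝ)⁻¹ := by
    rw [ha, ← Real.rpow_mul (by positivity), one_div, inv_mul_cancel₀ hp0.ne', Real.rpow_one]
  let f : (Fin d → ℤ) → ℂ := fun z => (g d a z : ℂ)
  have hf : lpZ d (ENNReal.ofReal p) (nnC f) ≤ 1 := by
    have hval : ∀ x, nnC f x ^ p = Set.indicator (A d : Set (Fin d → ℤ))
        (fun _ => ENNReal.ofReal ((n:ℝ)⁻¹)) x := by
      intro x
      by_cases hx : x ∈ (A d : Set (Fin d → ℤ))
      · have : nnC f x = ENNReal.ofReal a := by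
          simp only [nnC, f, g, Set.indicator_of_mem hx]
          rw [← enorm_eq_nnnorm, ← ofReal_norm, Complex.norm_real,
            Real.norm_of_nonneg ha0]
        rw [this, Set.indicator_of_mem hx, ENNReal.ofReal_rpow_of_nonneg ha0 hp0.le, hap]
      · simp [nnC, f, g, Set.indicator_of_notMem hx, hp0]
    rw [lpZ, if_neg ENNReal.ofReal_ne_top, hpR]
    simp only [hval]
    rw [← tsum_subtype, Finset.tsum_subtype' (A d) (fun _ => ENNReal.ofReal ((n:ℝ)⁻¹)),
      Finset.sum_const, ← hn, nsmul_eq_mul, ← ENNReal.ofReal_natCast n,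
      ← ENNReal.ofReal_mul hn0.le, mul_inv_cancel₀ hn0.ne']
    simp
  refine le_trans ?_ (le_iSup _ (⟨f, hf⟩ : {f : (Fin d → ℤ) → ℂ //
    lpZ d (ENNReal.ofReal p) (nnC f) ≤ 1}))
  rw [lpZ, if_neg ENNReal.ofReal_ne_top, hpR]
  set M : (Fin d → ℤ) → ℝ≥0∞ := fun x => ⨆ t : {t : ℝ // 0 < t},
              (‖discAvg d (ellipsoid d lam) (↑t) f x‖₊ : ℝ≥0∞) with hM
  set m := Nat.log 2 (d + 1) with hmdef
  have hmd : 2 ^ m ≤ d + 1 := Nat.pow_log_le_self 2 (by omega)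
  have hm1 : 1 ≤ m := by
    rw [hmdef]; exact Nat.log_pos (by norm_num) (by omega)
  have hMB : ∀ i < m, ∀ x ∈ B d i, ENNReal.ofReal (a / 4) ≤ M x := by
    intro i hi x hx
    obtain ⟨t, ht, h⟩ := avg_lower lam h1 hm h2 i
      ((Nat.pow_le_pow_right (by norm_num) hi).trans hmd) a ha0 x hx
    refine le_trans ?_ (le_iSup _ (⟨t, ht⟩ : {t : ℝ // 0 < t}))
    rw [← enorm_eq_nnnorm, ← ofReal_norm]
    exact ENNReal.ofReal_le_ofReal h
  have hcB : ∀ i < m, n ≤ (B d i).card := by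
    intro i hi
    have e1 : 2 ^ (i + 1) ≤ d + 1 := (Nat.pow_le_pow_right (by norm_num) hi).trans hmd
    have e2 : 2 ^ (i + 1) = 2 * 2 ^ i := by ring
    have e3 : 0 < 2 ^ i := by positivity
    refine card_B (j := ⟨2 ^ i - 1, by omega⟩) ?_
    show Nat.log 2 (2 ^ i - 1 + 1) = i
    rw [Nat.sub_add_cancel e3, Nat.log_pow (by norm_num)]
  have hsum : ENNReal.ofReal (m * (1 / 4) ^ p) ≤ ∑' x, M x ^ p := by
    have hq : (a / 4) ^ p = (n:ℝ)⁻¹ * (1 / 4) ^ p := by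
      rw [div_eq_mul_one_div, Real.mul_rpow ha0 (by norm_num), hap]
    calc ENNReal.ofReal (m * (1 / 4) ^ p)
        = ∑ i ∈ Finset.range m, ENNReal.ofReal ((1 / 4) ^ p) := by
          rw [Finset.sum_const, Finset.card_range, nsmul_eq_mul, ENNReal.ofReal_mul (by positivity),
            ENNReal.ofReal_natCast]
      _ ≤ ∑ i ∈ Finset.range m, ∑ x ∈ B d i, M x ^ p := by
          refine Finset.sum_le_sum fun i hi => ?_
          have hi' := Finset.mem_range.1 hi
          calc ENNReal.ofReal ((1 / 4) ^ p) = (n : ℝ≥0∞) * ENNReal.ofReal ((a / 4) ^ p) := by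
                rw [hq, ← ENNReal.ofReal_natCast n, ← ENNReal.ofReal_mul hn0.le, ← mul_assoc,
                  mul_inv_cancel₀ hn0.ne', one_mul]
            _ ≤ ((B d i).card : ℝ≥0∞) * ENNReal.ofReal ((a / 4) ^ p) := by
                gcongr
                exact hcB i hi'
            _ = ∑ x ∈ B d i, ENNReal.ofReal ((a / 4) ^ p) := by
                rw [Finset.sum_const, nsmul_eq_mul]
            _ ≤ _ := by
                refine Finset.sum_le_sum fun x hx => ?_
                rw [← ENNReal.ofReal_rpow_of_nonneg (by positivity) hp0.le]
                exact ENNReal.rpow_le_rpow (hMB i hi' x hx) hp0.le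
      _ = ∑ x ∈ (Finset.range m).biUnion (B d), M x ^ p := by
          rw [Finset.sum_biUnion]
          intro i _ i' _ h
          exact B_disj d h
      _ ≤ _ := ENNReal.sum_le_tsum _
  refine le_trans ?_ (ENNReal.rpow_le_rpow hsum (by positivity))
  rw [ENNReal.ofReal_rpow_of_nonneg (by positivity) (by positivity)]
  apply ENNReal.ofReal_le_ofReal
  rw [Real.mul_rpow (by positivity) (by positivity), ← Real.rpow_mul (by norm_num),
    mul_one_div_cancel hp0.ne', Real.rpow_one]
  have hlog : Real.log d ≤ 2 * m := by
    have e1 : d ≤ 2 ^ (m + 1) := by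
      have := Nat.lt_pow_succ_log_self (b := 2) (by norm_num) (d + 1)
      rw [← hmdef] at this
      have h3 : m.succ = m + 1 := rfl
      omega
    have e2 : Real.log d ≤ Real.log (2 ^ (m + 1)) :=
      Real.log_le_log (by exact_mod_cast hd) (by exact_mod_cast e1)
    rw [Real.log_pow] at e2
    have e3 : Real.log 2 ≤ 1 := by linarith [Real.log_two_lt_d9]
    have e4 : (1:ℝ) ≤ m := by exact_mod_cast hm1
    push_cast at e2
    nlinarith
  have hl0 : 0 ≤ Real.log d := Real.log_natCast_nonneg d
  have h3 : Real.log d ^ (1 / p) ≤ 2 * (m:ℝ) ^ (1 / p) := by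
    refine (Real.rpow_le_rpow hl0 hlog (by positivity)).trans ?_
    rw [Real.mul_rpow (by norm_num) (by positivity)]
    gcongr
    calc (2:ℝ) ^ (1 / p) ≤ 2 ^ (1:ℝ) := Real.rpow_le_rpow_of_exponent_le (by norm_num)
          (by rw [div_le_one hp0]; exact hp.le)
      _ = 2 := Real.rpow_one 2
  linarith
end
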